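/- Let V : (0,∞) → ℝ be measurable, essentially bounded, and compactly supported, and let h > 0, E > 0, m ≥ −h²/4, and ν := h⁻¹(m + h²/4)^{1/2}. Suppose u₀ : (0,∞) → ℂ is a not-identically-zero solution of −h² u'' + (V + m r⁻² − E) u = 0 (with u₀, u₀' locally absolutely continuous, equation holding a.e.) such that r^{−ν−1/2} u₀(r) is bounded as r → 0⁺, and u₁ : (0,∞) → ℂ is a not-identically-zero solution of the same equation such that sup_{r ≥ 1} |u₁(r)| < ∞ and u₁'(r) − i h⁻¹ E^{1/2} u₁(r) → 0 as r → ∞. Then u₀ and u₁ are linearly independent; equivalently, their Wronskian W := u₀ u₁' − u₀' u₁ (which is constant in r) is nonzero. -/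

import Mathlib

open MeasureTheory Set Filter

/-- `f` is locally absolutely continuous on `(0,∞)` with (a.e.) derivative `f'`. -/
def HasACDerivOn (f f' : ℝ → ℂ) : Prop :=
  ∀ a b : ℝ, 0 < a → a ≤ b →
    IntervalIntegrable f' volume a b ∧ f b - f a = ∫ x in a..b, f' x

/-- An indefinite integral of a complex integrable function is absolutely continuous. -/
theorem absolutelyContinuousOnInterval_integral_complex {f : ℝ → ℂ} {a b : ℝ}
    (hf : IntervalIntegrable f volume a b) :
    AbsolutelyContinuousOnInterval (fun x ↦ ∫ t in a..x, f t) a b := by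
  have hre : IntervalIntegrable (fun t ↦ (f t).re) volume a b := ⟨hf.1.re, hf.2.re⟩
  have him : IntervalIntegrable (fun t ↦ (f t).im) volume a b := ⟨hf.1.im, hf.2.im⟩
  have hconst : ∀ c : ℂ, AbsolutelyContinuousOnInterval (fun _ : ℝ ↦ c) a b := fun c ↦
    ((LipschitzWith.const c).lipschitzOnWith (s := uIcc a b)).absolutelyContinuousOnInterval
  have h1 := (hre.absolutelyContinuousOnInterval_intervalIntegral left_mem_uIcc).smul (hconst 1)
  have h2 := (him.absolutelyContinuousOnInterval_intervalIntegral left_mem_uIcc).smul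
    (hconst Complex.I)
  have h3 := h1.add h2
  rw [AbsolutelyContinuousOnInterval] at h3 ⊢
  refine h3.congr' ?_
  filter_upwards [mem_inf_of_right (mem_principal_self _)] with E hE
  refine Finset.sum_congr rfl fun i hi ↦ ?_
  have key : ∀ x ∈ uIcc a b, (∫ t in a..x, f t) =
      ((∫ t in a..x, (f t).re : ℝ) : ℂ) + ((∫ t in a..x, (f t).im : ℝ) : ℂ) * Complex.I := by
    intro x hx
    have hsub : IntervalIntegrable f volume a x := hf.mono_set (uIcc_subset_uIcc_left hx)
    apply Complex.ext
    · simpa using! (Complex.reCLM.intervalIntegral_comp_comm hsub).symm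
    · simpa using! (Complex.imCLM.intervalIntegral_comp_comm hsub).symm
  have hEi := hE.1 i hi
  rw [key _ hEi.1, key _ hEi.2]
  simp

namespace HasACDerivOn

variable {f f' g g' : ℝ → ℂ}

theorem eqOn_integral (hf : HasACDerivOn f f') {a x : ℝ} (ha : 0 < a) (hx : a ≤ x) :
    f x = f a + ∫ t in a..x, f' t := by
  rw [← (hf a x ha hx).2]; ring

theorem absolutelyContinuousOnInterval (hf : HasACDerivOn f f') {a b : ℝ} (ha : 0 < a)
    (hab : a ≤ b) : AbsolutelyContinuousOnInterval f a b := by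
  have h := absolutelyContinuousOnInterval_integral_complex (hf a b ha hab).1
  rw [AbsolutelyContinuousOnInterval] at h ⊢
  refine h.congr' ?_
  filter_upwards [mem_inf_of_right (mem_principal_self _)] with E hE
  refine Finset.sum_congr rfl fun i hi ↦ ?_
  have hEi := hE.1 i hi
  rw [uIcc_of_le hab] at hEi
  rw [hf.eqOn_integral ha hEi.1.1, hf.eqOn_integral ha hEi.2.1, dist_add_left]

theorem ae_hasDerivAt (hf : HasACDerivOn f f') {a b : ℝ} (ha : 0 < a) (hab : a ≤ b) :
    ∀ᵐ x, x ∈ uIcc a b → HasDerivAt f (f' x) x := by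
  filter_upwards [(hf a b ha hab).1.ae_hasDerivAt_integral, Measure.ae_ne volume a] with x hx hxa hxm
  have h1 := (hx hxm a left_mem_uIcc).const_add (f a)
  rw [uIcc_of_le hab] at hxm
  refine h1.congr_of_eventuallyEq ?_
  filter_upwards [Ioi_mem_nhds (lt_of_le_of_ne hxm.1 (Ne.symm hxa))] with y hy
  exact hf.eqOn_integral ha (le_of_lt hy)

end HasACDerivOn

theorem AbsolutelyContinuousOnInterval.integral_eq_sub_of_ae_hasDerivAt {f f' : ℝ → ℂ} {a b : ℝ}
    (hf : AbsolutelyContinuousOnInterval f a b) (hint : IntervalIntegrable f' volume a b)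
    (hd : ∀ᵐ x, x ∈ uIcc a b → HasDerivAt f (f' x) x) :
    f b - f a = ∫ x in a..b, f' x := by
  obtain ⟨C, hC⟩ := (hf.sub
    (absolutelyContinuousOnInterval_integral_complex hint)).const_of_ae_hasDerivAt_zero (by
      filter_upwards [hd, hint.ae_hasDerivAt_integral] with x hx1 hx2 hx
      simpa using! (hx1 hx).sub (hx2 hx a left_mem_uIcc))
  have h1 := hC a left_mem_uIcc
  have h2 := hC b right_mem_uIcc
  simp only [Pi.sub_apply, intervalIntegral.integral_same, sub_zero] at h1 h2
  rw [h1, ← h2]; ring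

namespace HasACDerivOn

variable {f f' g g' : ℝ → ℂ}

theorem continuousOn (hf : HasACDerivOn f f') : ContinuousOn f (Ioi 0) := by
  intro x hx
  have hx : 0 < x := hx
  have h := (hf.absolutelyContinuousOnInterval (half_pos hx) (by linarith : x / 2 ≤ 2 * x)).continuousOn
  rw [uIcc_of_le (by linarith)] at h
  exact (h.continuousAt (Icc_mem_nhds (by linarith) (by linarith))).continuousWithinAt

theorem continuousOn_uIcc (hf : HasACDerivOn f f') {a b : ℝ} (ha : 0 < a) (hab : a ≤ b) :
    ContinuousOn f (uIcc a b) :=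
  (hf.absolutelyContinuousOnInterval ha hab).continuousOn

theorem mul (hf : HasACDerivOn f f') (hg : HasACDerivOn g g') :
    HasACDerivOn (fun x ↦ f x * g x) (fun x ↦ f' x * g x + f x * g' x) := by
  intro a b ha hab
  have hint : IntervalIntegrable (fun x ↦ f' x * g x + f x * g' x) volume a b :=
    ((hf a b ha hab).1.mul_continuousOn (hg.continuousOn_uIcc ha hab)).add
      ((hg a b ha hab).1.continuousOn_mul (hf.continuousOn_uIcc ha hab))
  refine ⟨hint, ?_⟩
  refine AbsolutelyContinuousOnInterval.integral_eq_sub_of_ae_hasDerivAt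
    ((hf.absolutelyContinuousOnInterval ha hab).smul (hg.absolutelyContinuousOnInterval ha hab))
    hint ?_
  filter_upwards [hf.ae_hasDerivAt ha hab, hg.ae_hasDerivAt ha hab] with x h1 h2 hx
  exact (h1 hx).mul (h2 hx)

theorem sub (hf : HasACDerivOn f f') (hg : HasACDerivOn g g') :
    HasACDerivOn (fun x ↦ f x - g x) (fun x ↦ f' x - g' x) := by
  intro a b ha hab
  refine ⟨(hf a b ha hab).1.sub (hg a b ha hab).1, ?_⟩
  rw [intervalIntegral.integral_sub (hf a b ha hab).1 (hg a b ha hab).1, ← (hf a b ha hab).2,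
    ← (hg a b ha hab).2]
  ring

theorem add (hf : HasACDerivOn f f') (hg : HasACDerivOn g g') :
    HasACDerivOn (fun x ↦ f x + g x) (fun x ↦ f' x + g' x) := by
  intro a b ha hab
  refine ⟨(hf a b ha hab).1.add (hg a b ha hab).1, ?_⟩
  rw [intervalIntegral.integral_add (hf a b ha hab).1 (hg a b ha hab).1, ← (hf a b ha hab).2,
    ← (hg a b ha hab).2]
  ring

theorem const_mul (c : ℂ) (hf : HasACDerivOn f f') :
    HasACDerivOn (fun x ↦ c * f x) (fun x ↦ c * f' x) := by
  intro a b ha hab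
  refine ⟨(hf a b ha hab).1.const_mul c, ?_⟩
  rw [intervalIntegral.integral_const_mul, ← (hf a b ha hab).2, mul_sub]

theorem conj (hf : HasACDerivOn f f') :
    HasACDerivOn (fun x ↦ star (f x)) (fun x ↦ star (f' x)) := by
  intro a b ha hab
  have hi := (hf a b ha hab).1
  refine ⟨⟨Complex.conjCLE.toContinuousLinearMap.integrable_comp hi.1,
    Complex.conjCLE.toContinuousLinearMap.integrable_comp hi.2⟩, ?_⟩
  have h := Complex.conjCLE.toContinuousLinearMap.intervalIntegral_comp_comm hi
  rw [← (hf a b ha hab).2] at h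
  simpa using! h.symm

theorem of_hasDerivAt (hf : ∀ x, 0 < x → HasDerivAt f (f' x) x) (hc : ContinuousOn f' (Ioi 0)) :
    HasACDerivOn f f' := by
  intro a b ha hab
  have hsub : uIcc a b ⊆ Ioi 0 := by
    rw [uIcc_of_le hab]; exact fun x hx ↦ lt_of_lt_of_le ha hx.1
  have hi : IntervalIntegrable f' volume a b := (hc.mono hsub).intervalIntegrable
  exact ⟨hi, (intervalIntegral.integral_eq_sub_of_hasDerivAt (fun x hx ↦ hf x (hsub hx)) hi).symm⟩

/-- A function whose a.e. derivative has nonnegative real part has monotone real part. -/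
theorem re_le_of_ae_nonneg (hf : HasACDerivOn f f') {a b : ℝ} (ha : 0 < a) (hab : a ≤ b)
    (hnn : ∀ᵐ x, x ∈ Icc a b → 0 ≤ (f' x).re) : (f a).re ≤ (f b).re := by
  have hi := (hf a b ha hab).1
  have h := Complex.reCLM.intervalIntegral_comp_comm hi
  rw [← (hf a b ha hab).2] at h
  have h2 : 0 ≤ ∫ x in a..b, (f' x).re := by
    refine intervalIntegral.integral_nonneg_of_ae_restrict hab ?_
    rw [EventuallyLE, ae_restrict_iff' measurableSet_Icc]
    exact hnn
  have h3 : (∫ x in a..b, (f' x).re) = (f b - f a).re := by simpa using! h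
  rw [h3, Complex.sub_re] at h2
  linarith

end HasACDerivOn

/-- `u` is a (Carathéodory) solution of `u'' = q u` on `(0,∞)`. -/
structure IsODESolution (q : ℝ → ℝ) (u u' u'' : ℝ → ℂ) : Prop where
  hasACDerivOn : HasACDerivOn u u'
  hasACDerivOn_deriv : HasACDerivOn u' u''
  ae_eq : ∀ᵐ r, 0 < r → u'' r = q r * u r

namespace IsODESolution

variable {q : ℝ → ℝ} {u u' u'' v v' v'' : ℝ → ℂ}

theorem conj (hu : IsODESolution q u u' u'') :
    IsODESolution q (fun r ↦ star (u r)) (fun r ↦ star (u' r)) (fun r ↦ star (u'' r)) where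
  hasACDerivOn := hu.hasACDerivOn.conj
  hasACDerivOn_deriv := hu.hasACDerivOn_deriv.conj
  ae_eq := by
    filter_upwards [hu.ae_eq] with r hr h0
    rw [hr h0]
    simp

theorem sub_const_mul (hu : IsODESolution q u u' u'') (hv : IsODESolution q v v' v'') (c : ℂ) :
    IsODESolution q (fun r ↦ u r - c * v r) (fun r ↦ u' r - c * v' r)
      (fun r ↦ u'' r - c * v'' r) where
  hasACDerivOn := hu.hasACDerivOn.sub (hv.hasACDerivOn.const_mul c)
  hasACDerivOn_deriv := hu.hasACDerivOn_deriv.sub (hv.hasACDerivOn_deriv.const_mul c)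
  ae_eq := by
    filter_upwards [hu.ae_eq, hv.ae_eq] with r h1 h2 h0
    rw [h1 h0, h2 h0]
    ring

theorem wronskian_eq (hu : IsODESolution q u u' u'') (hv : IsODESolution q v v' v'')
    {a b : ℝ} (ha : 0 < a) (hb : 0 < b) :
    u a * v' a - u' a * v a = u b * v' b - u' b * v b := by
  wlog hab : a ≤ b generalizing a b
  · exact (this hb ha (le_of_not_ge hab)).symm
  have h := ((hu.hasACDerivOn.mul hv.hasACDerivOn_deriv).sub
    (hu.hasACDerivOn_deriv.mul hv.hasACDerivOn)) a b ha hab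
  have h0 : (∫ x in a..b, (u' x * v' x + u x * v'' x - (u'' x * v x + u' x * v' x))) = 0 := by
    refine intervalIntegral.integral_zero_ae ?_
    filter_upwards [hu.ae_eq, hv.ae_eq] with x h1 h2 hx
    rw [uIoc_of_le hab] at hx
    rw [h1 (ha.trans hx.1), h2 (ha.trans hx.1)]
    ring
  have h2 := h.2
  rw [h0] at h2
  exact (sub_eq_zero.mp h2).symm

/-- Monotonicity of the weighted energy `e (‖u'‖² + k² ‖u‖²)`, with the sign `σ` selecting whether
it is increasing or decreasing. -/
theorem energy_le (hu : IsODESolution q u u' u'') {k : ℝ} (hk : 0 < k) {σ : ℝ}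
    (hσ : |σ| = 1) {e e' : ℝ → ℝ} (he : ∀ x, 0 < x → HasDerivAt e (e' x) x)
    (he' : ContinuousOn e' (Ioi 0)) (henn : ∀ x, 0 ≤ e x) {a b : ℝ} (ha : 0 < a) (hab : a ≤ b)
    (hq : ∀ᵐ x, x ∈ Icc a b → |q x + k ^ 2| * e x ≤ k * (σ * e' x)) :
    σ * e a * (‖u' a‖ ^ 2 + k ^ 2 * ‖u a‖ ^ 2) ≤ σ * e b * (‖u' b‖ ^ 2 + k ^ 2 * ‖u b‖ ^ 2) := by
  have hE : HasACDerivOn (fun x ↦ ((e x : ℝ) : ℂ)) (fun x ↦ ((e' x : ℝ) : ℂ)) :=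
    .of_hasDerivAt (fun x hx ↦ (he x hx).ofReal_comp)
      (Complex.continuous_ofReal.comp_continuousOn he')
  have hG := (hE.const_mul (σ : ℂ)).mul
    ((hu.hasACDerivOn_deriv.mul hu.hasACDerivOn_deriv.conj).add
      ((hu.hasACDerivOn.mul hu.hasACDerivOn.conj).const_mul ((k : ℂ) ^ 2)))
  have hval : ∀ x, ((σ : ℂ) * (e x : ℂ) *
      (u' x * star (u' x) + (k : ℂ) ^ 2 * (u x * star (u x)))).re =
      σ * e x * (‖u' x‖ ^ 2 + k ^ 2 * ‖u x‖ ^ 2) := by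
    intro x
    simp only [Complex.star_def, Complex.mul_conj, Complex.normSq_eq_norm_sq]
    norm_cast
  rw [← hval a, ← hval b]
  refine hG.re_le_of_ae_nonneg ha hab ?_
  filter_upwards [hq, hu.ae_eq] with x h1 h2 hx
  have hx0 : 0 < x := ha.trans_le hx.1
  rw [h2 hx0]
  have h3 := h1 hx
  generalize u x = z at *
  generalize u' x = y at *
  have hre : ((σ : ℂ) * (e' x : ℂ) * (y * star y + (k : ℂ) ^ 2 * (z * star z)) +
      (σ : ℂ) * (e x : ℂ) * ((q x : ℂ) * z * star y + y * star ((q x : ℂ) * z) +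
        (k : ℂ) ^ 2 * (y * star z + z * star y))).re =
      σ * e' x * (y.re ^ 2 + y.im ^ 2 + k ^ 2 * (z.re ^ 2 + z.im ^ 2)) +
      σ * e x * (2 * (q x + k ^ 2) * (z.re * y.re + z.im * y.im)) := by
    simp [← Complex.ofReal_pow]
    ring
  rw [hre]
  set G := y.re ^ 2 + y.im ^ 2 + k ^ 2 * (z.re ^ 2 + z.im ^ 2) with hGdef
  set P := z.re * y.re + z.im * y.im with hP
  have hGP : 2 * k * |P| ≤ G := by
    rcases abs_cases P with ⟨h, _⟩ | ⟨h, _⟩ <;> rw [h]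
    · nlinarith [sq_nonneg (y.re - k * z.re), sq_nonneg (y.im - k * z.im)]
    · nlinarith [sq_nonneg (y.re + k * z.re), sq_nonneg (y.im + k * z.im)]
  have hGnn : 0 ≤ G := by positivity
  have h4 : |σ * e x * (2 * (q x + k ^ 2) * P)| = |q x + k ^ 2| * e x * (2 * |P|) := by
    simp only [abs_mul, hσ, abs_of_nonneg (henn x), abs_two]
    ring
  have h5 := neg_abs_le (σ * e x * (2 * (q x + k ^ 2) * P))
  rw [h4] at h5
  have h6 : |q x + k ^ 2| * e x * (2 * k * |P|) ≤ |q x + k ^ 2| * e x * G :=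
    mul_le_mul_of_nonneg_left hGP (mul_nonneg (abs_nonneg _) (henn x))
  have h7 : |q x + k ^ 2| * e x * G ≤ k * (σ * e' x) * G := mul_le_mul_of_nonneg_right h3 hGnn
  have h8 : 0 ≤ k * (σ * e' x * G - |q x + k ^ 2| * e x * (2 * |P|)) := by nlinarith
  have h9 := nonneg_of_mul_nonneg_right h8 hk
  linarith

theorem eq_zero_of_energy_nonpos {y z : ℂ} {k e : ℝ} (hk : 0 < k) (he : 0 < e)
    (h : e * (‖y‖ ^ 2 + k ^ 2 * ‖z‖ ^ 2) ≤ 0) : z = 0 ∧ y = 0 := by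
  have h1 : ‖y‖ ^ 2 + k ^ 2 * ‖z‖ ^ 2 ≤ 0 := nonpos_of_mul_nonpos_right h he
  have h2 : 0 ≤ k ^ 2 * ‖z‖ ^ 2 := by positivity
  have h3 : ‖y‖ ^ 2 = 0 := by nlinarith [sq_nonneg ‖y‖]
  have h4 : k ^ 2 * ‖z‖ ^ 2 = 0 := by nlinarith [sq_nonneg ‖y‖]
  have h5 : ‖z‖ ^ 2 = 0 := by
    rcases mul_eq_zero.mp h4 with h | h
    · exact absurd h (by positivity)
    · exact h
  exact ⟨by simpa using h5, by simpa using h3⟩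

/-- Uniqueness for the initial value problem. -/
theorem eq_zero_of_initial (hu : IsODESolution q u u' u'')
    (hq : ∀ a b : ℝ, 0 < a → ∃ M : ℝ, ∀ᵐ x, x ∈ Icc a b → |q x| ≤ M)
    {p : ℝ} (hp : 0 < p) (h0 : u p = 0) (h0' : u' p = 0) {x : ℝ} (hx : 0 < x) :
    u x = 0 ∧ u' x = 0 := by
  have hexp : ∀ c y : ℝ, HasDerivAt (fun t ↦ Real.exp (c * t)) (c * Real.exp (c * y)) y := by
    intro c y
    have h := ((hasDerivAt_id y).const_mul c).exp
    simpa [mul_comm] using h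
  have hcont : ∀ c : ℝ, ContinuousOn (fun y : ℝ ↦ c * Real.exp (c * y)) (Ioi 0) := by
    intro c
    fun_prop
  rcases le_total p x with hpx | hpx
  · obtain ⟨M, hM⟩ := hq p x hp
    have h := hu.energy_le one_pos (σ := -1) (by norm_num) (fun y _ ↦ hexp (-(M + 1)) y)
      (hcont _) (fun y ↦ (Real.exp_pos _).le) hp hpx (by
        filter_upwards [hM] with y hy hyI
        have h1 : |q y + 1 ^ 2| ≤ M + 1 := by
          have h2 := abs_add_le (q y) (1 ^ 2)
          have h3 := hy hyI
          norm_num at h2 ⊢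
          linarith
        have h2 := mul_le_mul_of_nonneg_right h1 (Real.exp_pos (-(M + 1) * y)).le
        linarith)
    rw [h0, h0'] at h
    refine eq_zero_of_energy_nonpos one_pos (Real.exp_pos (-(M + 1) * x)) ?_
    simp at h ⊢
    linarith
  · obtain ⟨M, hM⟩ := hq x p hx
    have h := hu.energy_le one_pos (σ := 1) (by norm_num) (fun y _ ↦ hexp (M + 1) y)
      (hcont _) (fun y ↦ (Real.exp_pos _).le) hx hpx (by
        filter_upwards [hM] with y hy hyI
        have h1 : |q y + 1 ^ 2| ≤ M + 1 := by
          have h2 := abs_add_le (q y) (1 ^ 2)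
          have h3 := hy hyI
          norm_num at h2 ⊢
          linarith
        have h2 := mul_le_mul_of_nonneg_right h1 (Real.exp_pos ((M + 1) * y)).le
        linarith)
    rw [h0, h0'] at h
    refine eq_zero_of_energy_nonpos one_pos (Real.exp_pos ((M + 1) * x)) ?_
    simp at h ⊢
    linarith

/-- For an inverse-square perturbation of `-k²`, a solution decaying at infinity together with its
derivative vanishes near infinity. -/
theorem eq_zero_of_tendsto_zero (hu : IsODESolution q u u' u'') {k c R : ℝ} (hk : 0 < k)
    (hR : 0 < R) (hq : ∀ r, R ≤ r → q r + k ^ 2 = c * (r ^ 2)⁻¹)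
    (h0 : Tendsto u atTop (nhds 0)) (h0' : Tendsto u' atTop (nhds 0)) :
    u R = 0 ∧ u' R = 0 := by
  set A := |c| / k with hA
  have hAnn : 0 ≤ A := by positivity
  set e : ℝ → ℝ := fun x ↦ Real.exp (-A * x⁻¹) with he
  have hder : ∀ x : ℝ, 0 < x → HasDerivAt e (Real.exp (-A * x⁻¹) * (A * (x ^ 2)⁻¹)) x := by
    intro x hx
    have h := ((hasDerivAt_inv hx.ne').const_mul (-A)).exp
    convert h using 1
    ring
  have hcont : ContinuousOn (fun x : ℝ ↦ Real.exp (-A * x⁻¹) * (A * (x ^ 2)⁻¹)) (Ioi 0) := by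
    have h1 : ContinuousOn (fun x : ℝ ↦ x⁻¹) (Ioi 0) :=
      continuousOn_inv₀.mono fun x hx ↦ ne_of_gt hx
    have h2 : ContinuousOn (fun x : ℝ ↦ (x ^ 2)⁻¹) (Ioi 0) :=
      ContinuousOn.inv₀ (by fun_prop) fun x hx ↦ pow_ne_zero 2 (ne_of_gt hx)
    exact (Real.continuous_exp.comp_continuousOn (continuousOn_const.mul h1)).mul
      (continuousOn_const.mul h2)
  have hmono : ∀ b, R ≤ b → e R * (‖u' R‖ ^ 2 + k ^ 2 * ‖u R‖ ^ 2) ≤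
      ‖u' b‖ ^ 2 + k ^ 2 * ‖u b‖ ^ 2 := by
    intro b hb
    have h := hu.energy_le hk (σ := 1) (by norm_num) hder hcont
      (fun y ↦ (Real.exp_pos _).le) hR hb (by
        refine Eventually.of_forall fun y hy ↦ ?_
        have hy0 : 0 < y := hR.trans_le hy.1
        rw [hq y hy.1, abs_mul, abs_of_pos (by positivity : 0 < (y ^ 2)⁻¹),
          show |c| = k * A by rw [hA]; field_simp]
        exact le_of_eq (by ring))
    have h1 : e b ≤ 1 := by
      refine Real.exp_le_one_iff.mpr ?_
      have : 0 < b⁻¹ := inv_pos.mpr (hR.trans_le hb)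
      nlinarith
    have h2 : 0 ≤ ‖u' b‖ ^ 2 + k ^ 2 * ‖u b‖ ^ 2 := by positivity
    simp only [one_mul] at h
    nlinarith
  have hlim : Tendsto (fun b ↦ ‖u' b‖ ^ 2 + k ^ 2 * ‖u b‖ ^ 2) atTop (nhds 0) := by
    simpa using (h0'.norm.pow 2).add ((h0.norm.pow 2).const_mul (k ^ 2))
  have h := ge_of_tendsto hlim (eventually_atTop.mpr ⟨R, hmono⟩)
  exact eq_zero_of_energy_nonpos hk (Real.exp_pos (-A * R⁻¹)) h

end IsODESolution

theorem hasACDerivOn_rpow (t : ℝ) :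
    HasACDerivOn (fun x ↦ ((x ^ t : ℝ) : ℂ)) (fun x ↦ ((t * x ^ (t - 1) : ℝ) : ℂ)) :=
  .of_hasDerivAt (fun _ hx ↦ (Real.hasDerivAt_rpow_const (Or.inl hx.ne')).ofReal_comp)
    (Complex.continuous_ofReal.comp_continuousOn
      (continuousOn_const.mul (continuousOn_id.rpow_const fun _ hx ↦ Or.inl (ne_of_gt hx))))

theorem hasACDerivOn_log :
    HasACDerivOn (fun x ↦ ((Real.log x : ℝ) : ℂ)) (fun x ↦ ((x⁻¹ : ℝ) : ℂ)) :=
  .of_hasDerivAt (fun _ hx ↦ (Real.hasDerivAt_log hx.ne').ofReal_comp)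
    (Complex.continuous_ofReal.comp_continuousOn
      (continuousOn_inv₀.mono fun _ hx ↦ ne_of_gt hx))

namespace IsODESolution

variable {u u' u'' : ℝ → ℂ} {q : ℝ → ℝ}

/-- A recessive solution at `0` has vanishing Wronskian with its complex conjugate. -/
theorem wronskian_conj_eq_zero (hu : IsODESolution q u u' u'') {s K C δ : ℝ} (hs : 1 / 2 ≤ s)
    (hδ : 0 < δ) (hδ1 : δ ≤ 1) (hK : 0 ≤ K) (hq : ∀ᵐ r, 0 < r → |q r - s * (s - 1) * (r ^ 2)⁻¹| ≤ K)
    (hC : ∀ r ∈ Ioo 0 δ, ‖u r‖ ≤ C * r ^ s) {p : ℝ} (hp : 0 < p) :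
    u p * star (u' p) - u' p * star (u p) = 0 := by
  set c := u p * star (u' p) - u' p * star (u p) with hc
  by_contra hc0
  have hcr : ∀ r, 0 < r → u r * star (u' r) - u' r * star (u r) = c := fun r hr ↦
    hu.wronskian_eq hu.conj hr hp
  have hsub1 : ∀ x : ℝ, 0 < x → x ^ (s - 1) = x ^ s * x⁻¹ := fun x hx ↦ by
    rw [Real.rpow_sub_one hx.ne', div_eq_mul_inv]
  have hsub2 : ∀ x : ℝ, 0 < x → x ^ (s - 1 - 1) = x ^ s * (x ^ 2)⁻¹ := fun x hx ↦ by
    rw [Real.rpow_sub_one hx.ne', hsub1 x hx]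
    field_simp
  have hneg1 : ∀ x : ℝ, 0 < x → x ^ (-s - 1) = (x ^ s)⁻¹ * x⁻¹ := fun x hx ↦ by
    rw [Real.rpow_sub_one hx.ne', div_eq_mul_inv, Real.rpow_neg hx.le]
  set v : ℝ → ℂ := fun x ↦ ((x ^ (-s) : ℝ) : ℂ) * u x with hv
  set w : ℝ → ℂ := fun x ↦ ((x ^ s : ℝ) : ℂ) * u' x - ((s : ℝ) : ℂ) * (((x ^ (s - 1) : ℝ) : ℂ) * u x)
    with hw
  have hwAC := ((hasACDerivOn_rpow s).mul hu.hasACDerivOn_deriv).sub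
    (((hasACDerivOn_rpow (s - 1)).mul hu.hasACDerivOn).const_mul ((s : ℝ) : ℂ))
  have hvAC := (hasACDerivOn_rpow (-s)).mul hu.hasACDerivOn
  have hvb : ∀ r ∈ Ioo 0 δ, ‖v r‖ ≤ C := by
    intro r hr
    have hpos := Real.rpow_pos_of_pos hr.1 s
    simp only [hv, norm_mul, Complex.norm_real, Real.norm_eq_abs, Real.rpow_neg hr.1.le]
    rw [abs_of_pos (inv_pos.mpr hpos), inv_mul_le_iff₀ hpos, mul_comm]
    exact hC r hr
  have hcw : ∀ r, 0 < r → c = v r * star (w r) - w r * star (v r) := by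
    intro r hr
    have hpos : ((r ^ s : ℝ) : ℂ) ≠ 0 := by
      exact_mod_cast (Real.rpow_pos_of_pos hr s).ne'
    rw [← hcr r hr]
    simp only [hv, hw, Real.rpow_neg hr.le, hsub1 r hr, star_mul', star_sub]
    simp only [Complex.star_def, Complex.conj_ofReal]
    push_cast
    field_simp
    ring
  have hCnn : 0 ≤ C := (norm_nonneg _).trans (hvb (δ / 2) ⟨by linarith, by linarith⟩)
  have hwlow : ∀ r ∈ Ioo 0 δ, ‖c‖ ≤ 2 * C * ‖w r‖ := by
    intro r hr
    rw [hcw r hr.1]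
    refine (norm_sub_le _ _).trans ?_
    rw [norm_mul (v r), norm_mul (w r), norm_star, norm_star]
    nlinarith [hvb r hr, norm_nonneg (w r)]
  have hcpos : 0 < ‖c‖ := norm_pos_iff.mpr hc0
  have hCpos : 0 < C := by
    refine lt_of_le_of_ne hCnn fun h ↦ ?_
    have := hwlow (δ / 2) ⟨by linarith, by linarith⟩
    rw [← h] at this
    linarith
  have hwlip : ∀ a b, 0 < a → a ≤ b → b < δ → ‖w b - w a‖ ≤ K * C * (b - a) := by
    intro a b ha hab hb
    have h := (hwAC a b ha hab).2
    rw [← abs_of_nonneg (sub_nonneg.mpr hab)]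
    simp only [hw]
    rw [h]
    refine intervalIntegral.norm_integral_le_of_norm_le_const_ae ?_
    filter_upwards [hq, hu.ae_eq] with x hx1 hx2 hx
    rw [uIoc_of_le hab] at hx
    have hx0 : 0 < x := ha.trans hx.1
    have hxδ : x < δ := hx.2.trans_lt hb
    rw [hx2 hx0]
    have heq : ((s * x ^ (s - 1) : ℝ) : ℂ) * u' x + ((x ^ s : ℝ) : ℂ) * ((q x : ℂ) * u x) -
        ((s : ℝ) : ℂ) * ((((s - 1) * x ^ (s - 1 - 1) : ℝ) : ℂ) * u x +
          ((x ^ (s - 1) : ℝ) : ℂ) * u' x) =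
        ((x ^ s * (q x - s * (s - 1) * (x ^ 2)⁻¹) : ℝ) : ℂ) * u x := by
      rw [hsub2 x hx0]
      push_cast
      ring
    have hpos := Real.rpow_pos_of_pos hx0 s
    have hle1 : x ^ s ≤ 1 := Real.rpow_le_one hx0.le (by linarith) (by linarith)
    rw [heq, norm_mul, Complex.norm_real, Real.norm_eq_abs, abs_mul, abs_of_pos hpos]
    calc x ^ s * |q x - s * (s - 1) * (x ^ 2)⁻¹| * ‖u x‖
        ≤ 1 * K * (C * 1) := by
          gcongr
          · exact hx1 hx0
          · exact (hC x ⟨hx0, hxδ⟩).trans (by gcongr)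
      _ = K * C := by ring
  obtain ⟨b, hb0, hbδ, hbs⟩ : ∃ b, 0 < b ∧ b < δ ∧ 2 * C * (K * C * b) ≤ ‖c‖ / 2 := by
    have h1 : Tendsto (fun b : ℝ ↦ 2 * C * (K * C * b)) (nhdsWithin 0 (Ioi 0)) (nhds 0) := by
      have : Continuous (fun b : ℝ ↦ 2 * C * (K * C * b)) := by fun_prop
      simpa using (this.tendsto 0).mono_left nhdsWithin_le_nhds
    have h2 := (h1.eventually (ge_mem_nhds (half_pos hcpos))).and (Ioo_mem_nhdsGT hδ)
    obtain ⟨b, hb1, hb2⟩ := h2.exists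
    exact ⟨b, hb2.1, hb2.2, hb1⟩
  set L := w b with hL
  have hLlow := hwlow b ⟨hb0, hbδ⟩
  have hLpos : 0 < ‖L‖ := by
    by_contra h
    have : ‖L‖ = 0 := le_antisymm (not_lt.mp h) (norm_nonneg _)
    rw [← hL, this] at hLlow
    linarith
  have hwre : ∀ r, 0 < r → r ≤ b → ‖L‖ ^ 2 / 2 ≤ (w r * star L).re := by
    intro r hr hrb
    have h1 : ‖L - w r‖ ≤ ‖L‖ / 2 := by
      have h2 := hwlip r b hr hrb hbδ
      have h3 : K * C * (b - r) ≤ K * C * b := by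
        have : 0 ≤ K * C := by positivity
        nlinarith
      have h4 : 2 * C * ‖L - w r‖ ≤ 2 * C * (K * C * b) := by gcongr; exact h2.trans h3
      have h5 : 2 * C * ‖L - w r‖ ≤ 2 * C * (‖L‖ / 2) := by linarith
      exact le_of_mul_le_mul_left h5 (by positivity)
    have h2 : w r * star L = L * star L - (L - w r) * star L := by ring
    have h3 : (L * star L).re = ‖L‖ ^ 2 := by
      rw [Complex.star_def, Complex.mul_conj, Complex.normSq_eq_norm_sq, Complex.ofReal_re]
    have h4 : ((L - w r) * star L).re ≤ ‖L‖ / 2 * ‖L‖ := by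
      refine (Complex.re_le_norm _).trans ?_
      rw [norm_mul, norm_star]
      gcongr
    rw [h2, Complex.sub_re, h3]
    nlinarith
  have hmono : ∀ r, 0 < r → r ≤ b →
      (v r * star L).re - ‖L‖ ^ 2 / 2 * Real.log r ≤
        (v b * star L).re - ‖L‖ ^ 2 / 2 * Real.log b := by
    intro r hr hrb
    have h := ((hvAC.const_mul (star L)).sub
      (hasACDerivOn_log.const_mul ((‖L‖ ^ 2 / 2 : ℝ) : ℂ))).re_le_of_ae_nonneg hr hrb (by
        refine Eventually.of_forall fun x hx ↦ ?_
        have hx0 : 0 < x := hr.trans_le hx.1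
        have hpos := Real.rpow_pos_of_pos hx0 s
        have hposC : ((x ^ s : ℝ) : ℂ) ≠ 0 := by exact_mod_cast hpos.ne'
        have hxC : (x : ℂ) ≠ 0 := by exact_mod_cast hx0.ne'
        have heq : star L * (((-s * x ^ (-s - 1) : ℝ) : ℂ) * u x + ((x ^ (-s) : ℝ) : ℂ) * u' x) =
            (((x ^ s)⁻¹ ^ 2 : ℝ) : ℂ) * (w x * star L) := by
          simp only [hw]
          rw [hneg1 x hx0, hsub1 x hx0, Real.rpow_neg hx0.le]
          push_cast
          field_simp
          ring
        have hinv : x⁻¹ ≤ (x ^ s)⁻¹ ^ 2 := by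
          rw [inv_pow]
          refine inv_anti₀ (by positivity) ?_
          rw [← Real.rpow_natCast, ← Real.rpow_mul hx0.le]
          refine (Real.rpow_le_rpow_of_exponent_ge hx0 (by linarith [hx.2])
            (by norm_num; linarith : (1 : ℝ) ≤ s * ((2 : ℕ) : ℝ))).trans_eq (Real.rpow_one x)
        rw [heq, Complex.sub_re, Complex.re_ofReal_mul, Complex.re_ofReal_mul, Complex.ofReal_re]
        have h1 := hwre x hx0 hx.2
        have h2 : 0 ≤ ‖L‖ ^ 2 / 2 := by positivity
        have h3 : 0 ≤ x⁻¹ := by positivity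
        have h4 := mul_le_mul hinv h1 h2 (by positivity)
        linarith)
    simp only [Complex.sub_re, Complex.re_ofReal_mul, Complex.ofReal_re] at h
    rw [mul_comm (v r), mul_comm (v b)]
    exact h
  set B := (v b * star L).re - ‖L‖ ^ 2 / 2 * Real.log b with hB
  obtain ⟨r, hr1, hr2⟩ := ((Real.tendsto_log_nhdsGT_zero.eventually
    (eventually_lt_atBot (-(B + C * ‖L‖) / (‖L‖ ^ 2 / 2)))).and (Ioo_mem_nhdsGT hb0)).exists
  have h1 := hmono r hr2.1 hr2.2.le
  have h2 : -(C * ‖L‖) ≤ (v r * star L).re := by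
    have h3 := (abs_le.mp (Complex.abs_re_le_norm (v r * star L))).1
    rw [norm_mul, norm_star] at h3
    have h4 := hvb r ⟨hr2.1, hr2.2.trans hbδ⟩
    nlinarith
  rw [lt_div_iff₀ (by positivity)] at hr1
  linarith

end IsODESolution

/-- An outgoing solution with vanishing conjugate Wronskian decays at infinity. -/
theorem tendsto_zero_of_outgoing {u u' : ℝ → ℂ} {k C : ℝ} (hk : 0 < k)
    (hb : ∀ r, 1 ≤ r → ‖u r‖ ≤ C)
    (hout : Tendsto (fun r ↦ u' r - Complex.I * (k : ℂ) * u r) atTop (nhds 0))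
    (hW : ∀ r, 0 < r → u r * star (u' r) - u' r * star (u r) = 0) :
    Tendsto u atTop (nhds 0) ∧ Tendsto u' atTop (nhds 0) := by
  have hbd : ∀ f : ℝ → ℂ, Tendsto f atTop (nhds 0) →
      Tendsto (fun r ↦ f r * star (u r)) atTop (nhds 0) := by
    intro f hf
    refine squeeze_zero_norm' (a := fun r ↦ ‖f r‖ * C) ?_ (by simpa using hf.norm.mul_const C)
    filter_upwards [eventually_ge_atTop 1] with r hr
    rw [norm_mul, norm_star]
    exact mul_le_mul_of_nonneg_left (hb r hr) (norm_nonneg _)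
  have h1 := hbd _ hout
  have h2 := (h1.star).sub h1
  have h3 : Tendsto (fun r ↦ ‖u r‖ ^ 2) atTop (nhds 0) := by
    have h4 := h2.norm.div_const (2 * k)
    simp only [star_zero, sub_zero, norm_zero, zero_div] at h4
    refine h4.congr' ?_
    filter_upwards [eventually_gt_atTop 0] with r hr
    have h5 : star ((u' r - Complex.I * (k : ℂ) * u r) * star (u r)) -
        (u' r - Complex.I * (k : ℂ) * u r) * star (u r) =
        2 * Complex.I * (k : ℂ) * (u r * star (u r)) := by
      have := hW r hr
      simp only [Complex.star_def, map_mul, map_sub, Complex.conj_conj, Complex.conj_I,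
        Complex.conj_ofReal] at this ⊢
      linear_combination this
    rw [h5]
    simp only [norm_mul, norm_star, Complex.norm_I, Complex.norm_real, Real.norm_eq_abs,
      abs_of_pos hk, Complex.norm_ofNat]
    field_simp
  have h0 : Tendsto u atTop (nhds 0) := by
    rw [tendsto_zero_iff_norm_tendsto_zero]
    have h := h3.sqrt
    simpa [Real.sqrt_sq (norm_nonneg _)] using h
  refine ⟨h0, ?_⟩
  simpa using hout.add (h0.const_mul (Complex.I * (k : ℂ)))

theorem isODESolution_of_radial {V : ℝ → ℝ} {h E m : ℝ} (hh : 0 < h) {u u' u'' : ℝ → ℂ}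
    (hu : HasACDerivOn u u') (hu' : HasACDerivOn u' u'')
    (heq : ∀ᵐ r ∂(volume.restrict (Ioi (0 : ℝ))),
      -(h : ℂ) ^ 2 * u'' r + ((V r + m * (r ^ 2)⁻¹ - E : ℝ) : ℂ) * u r = 0) :
    IsODESolution (fun r ↦ (V r + m * (r ^ 2)⁻¹ - E) / h ^ 2) u u' u'' where
  hasACDerivOn := hu
  hasACDerivOn_deriv := hu'
  ae_eq := by
    rw [ae_restrict_iff' measurableSet_Ioi] at heq
    filter_upwards [heq] with r hr h0
    have hhC : (h : ℂ) ≠ 0 := by exact_mod_cast hh.ne'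
    have h1 := hr h0
    rw [Complex.ofReal_div, Complex.ofReal_pow, div_mul_eq_mul_div, eq_div_iff (pow_ne_zero 2 hhC)]
    linear_combination -h1

/-- Two nontrivial solutions whose Wronskian vanishes at a point are proportional. -/
theorem IsODESolution.exists_eq_const_mul {q : ℝ → ℝ} {u u' u'' v v' v'' : ℝ → ℂ}
    (hu : IsODESolution q u u' u'') (hv : IsODESolution q v v' v'')
    (hq : ∀ a b : ℝ, 0 < a → ∃ M : ℝ, ∀ᵐ x, x ∈ Icc a b → |q x| ≤ M)
    (hnt : ∃ r ∈ Ioi (0 : ℝ), u r ≠ 0) {p : ℝ} (hp : 0 < p)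
    (hW : u p * v' p - u' p * v p = 0) :
    ∃ c : ℂ, ∀ r, 0 < r → v r = c * u r := by
  obtain ⟨c, hc, hc'⟩ : ∃ c : ℂ, v p - c * u p = 0 ∧ v' p - c * u' p = 0 := by
    by_cases h0 : u p = 0
    · have h0' : u' p ≠ 0 := fun h ↦ by
        obtain ⟨r, hr, hr'⟩ := hnt
        exact hr' (hu.eq_zero_of_initial hq hp h0 h hr).1
      refine ⟨v' p / u' p, ?_, by field_simp; ring⟩
      rw [h0] at hW ⊢
      have : v p = 0 := by simpa [h0'] using hW
      simp [this]
    · refine ⟨v p / u p, by field_simp; ring, ?_⟩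
      field_simp
      linear_combination hW
  exact ⟨c, fun r hr ↦ sub_eq_zero.mp
    ((hv.sub_const_mul hu c).eq_zero_of_initial hq hp hc hc' hr).1⟩

/-- Linear independence of the recessive solution `u₀` at `0` and the outgoing
solution `u₁` at infinity of `-h²u'' + (V + m r⁻² - E)u = 0`: their Wronskian
`W = u₀u₁' - u₀'u₁` is constant on `(0,∞)` and nonzero. -/
theorem wronskian_ne_zero
    (V : ℝ → ℝ) (hVmeas : Measurable V)
    (hVbdd : ∃ Cv : ℝ, ∀ᵐ r ∂(volume.restrict (Ioi (0 : ℝ))), |V r| ≤ Cv)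
    (hVsupp : HasCompactSupport V)
    (h E m : ℝ) (hh : 0 < h) (hE : 0 < E) (hm : -h ^ 2 / 4 ≤ m)
    (ν : ℝ) (hν : ν = Real.sqrt (m + h ^ 2 / 4) / h)
    (u₀ u₀' u₀'' u₁ u₁' u₁'' : ℝ → ℂ)
    (hu₀ : HasACDerivOn u₀ u₀') (hu₀' : HasACDerivOn u₀' u₀'')
    (heq₀ : ∀ᵐ r ∂(volume.restrict (Ioi (0 : ℝ))),
      -(h : ℂ) ^ 2 * u₀'' r + ((V r + m * (r ^ 2)⁻¹ - E : ℝ) : ℂ) * u₀ r = 0)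
    (hnt₀ : ∃ r ∈ Ioi (0 : ℝ), u₀ r ≠ 0)
    (hrec : ∃ δ > (0 : ℝ), ∃ C : ℝ, ∀ r ∈ Ioo (0 : ℝ) δ,
      ‖u₀ r‖ ≤ C * r ^ (ν + 1 / 2))
    (hu₁ : HasACDerivOn u₁ u₁') (hu₁' : HasACDerivOn u₁' u₁'')
    (heq₁ : ∀ᵐ r ∂(volume.restrict (Ioi (0 : ℝ))),
      -(h : ℂ) ^ 2 * u₁'' r + ((V r + m * (r ^ 2)⁻¹ - E : ℝ) : ℂ) * u₁ r = 0)
    (hnt₁ : ∃ r ∈ Ioi (0 : ℝ), u₁ r ≠ 0)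
    (hbdd₁ : ∃ C : ℝ, ∀ r : ℝ, 1 ≤ r → ‖u₁ r‖ ≤ C)
    (hout : Tendsto (fun r : ℝ => u₁' r - Complex.I * (Real.sqrt E / h : ℝ) * u₁ r)
      atTop (nhds 0)) :
    (∀ r ∈ Ioi (0 : ℝ), ∀ r' ∈ Ioi (0 : ℝ),
      u₀ r * u₁' r - u₀' r * u₁ r = u₀ r' * u₁' r' - u₀' r' * u₁ r') ∧
    ∀ r ∈ Ioi (0 : ℝ), u₀ r * u₁' r - u₀' r * u₁ r ≠ 0 := by
  have hs₀ := isODESolution_of_radial hh hu₀ hu₀' heq₀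
  have hs₁ := isODESolution_of_radial hh hu₁ hu₁' heq₁
  refine ⟨fun r hr r' hr' ↦ hs₀.wronskian_eq hs₁ hr hr', fun p hp hW ↦ ?_⟩
  obtain ⟨Cv, hCv⟩ := hVbdd
  rw [ae_restrict_iff' measurableSet_Ioi] at hCv
  have hh2 : 0 < h ^ 2 := by positivity
  have hq : ∀ a b : ℝ, 0 < a → ∃ M : ℝ, ∀ᵐ x, x ∈ Icc a b →
      |(V x + m * (x ^ 2)⁻¹ - E) / h ^ 2| ≤ M := by
    intro a b ha
    refine ⟨(Cv + |m| * (a ^ 2)⁻¹ + |E|) / h ^ 2, ?_⟩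
    filter_upwards [hCv] with x hx hxI
    rw [abs_div, abs_of_pos hh2]
    have h1 := hx (ha.trans_le hxI.1)
    have h2 : |m * (x ^ 2)⁻¹| ≤ |m| * (a ^ 2)⁻¹ := by
      rw [abs_mul, abs_of_nonneg (by positivity : 0 ≤ (x ^ 2)⁻¹)]
      have := hxI.1
      gcongr
    gcongr
    calc |V x + m * (x ^ 2)⁻¹ - E| ≤ |V x + m * (x ^ 2)⁻¹| + |E| := abs_sub _ _
      _ ≤ |V x| + |m * (x ^ 2)⁻¹| + |E| := by gcongr; exact abs_add_le _ _
      _ ≤ _ := by gcongr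
  obtain ⟨c, hc⟩ := hs₀.exists_eq_const_mul hs₁ hq hnt₀ hp hW
  obtain ⟨δ, hδ, C, hC⟩ := hrec
  have hνnn : 0 ≤ ν := by rw [hν]; positivity
  have hν2 : (ν + 1 / 2) * (ν + 1 / 2 - 1) = m / h ^ 2 := by
    have : ν ^ 2 = (m + h ^ 2 / 4) / h ^ 2 := by
      rw [hν, div_pow, Real.sq_sqrt (by linarith)]
    have h2 : (m + h ^ 2 / 4) / h ^ 2 = m / h ^ 2 + 1 / 4 := by field_simp
    linarith
  have hWconj : ∀ r, 0 < r → u₁ r * star (u₁' r) - u₁' r * star (u₁ r) = 0 := fun r hr ↦ by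
    refine hs₁.wronskian_conj_eq_zero (s := ν + 1 / 2) (K := (|Cv| + |E|) / h ^ 2)
      (C := ‖c‖ * C) (δ := min δ 1) (by linarith) (lt_min hδ one_pos) (min_le_right _ _)
      (by positivity) ?_ ?_ hr
    · filter_upwards [hCv] with x hx hx0
      have h1 : (V x + m * (x ^ 2)⁻¹ - E) / h ^ 2 -
          (ν + 1 / 2) * (ν + 1 / 2 - 1) * (x ^ 2)⁻¹ = (V x - E) / h ^ 2 := by
        rw [hν2]
        ring
      rw [h1, abs_div, abs_of_pos hh2]
      gcongr
      exact (abs_sub _ _).trans (by linarith [hx hx0, le_abs_self Cv])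
    · intro x hx
      rw [hc x hx.1, norm_mul, mul_assoc]
      gcongr
      exact hC x ⟨hx.1, hx.2.trans_le (min_le_left _ _)⟩
  obtain ⟨C₁, hC₁⟩ := hbdd₁
  have hk : 0 < Real.sqrt E / h := div_pos (Real.sqrt_pos.mpr hE) hh
  obtain ⟨hlim, hlim'⟩ := tendsto_zero_of_outgoing hk hC₁ hout hWconj
  obtain ⟨R, hR⟩ := hVsupp.isCompact.isBounded.exists_norm_le
  have hV0 : ∀ r, max R 0 + 1 ≤ r → V r = 0 := by
    intro r hr
    by_contra hne
    have h1 := hR r (subset_tsupport V hne)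
    have h2 := (le_abs_self r).trans h1
    linarith [le_max_left R 0]
  have hpos : 0 < max R 0 + 1 := by linarith [le_max_right R 0]
  have hzero := hs₁.eq_zero_of_tendsto_zero (c := m / h ^ 2) hk hpos (fun r hr ↦ by
    rw [hV0 r hr, div_pow, Real.sq_sqrt hE.le]
    ring) hlim hlim'
  obtain ⟨r, hr, hr'⟩ := hnt₁
  exact hr' (hs₁.eq_zero_of_initial hq hpos hzero.1 hzero.2 hr).1
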